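/- arXiv:1612.07168 — 2 statements merged into one kernel-verified Lean document; each statement's English description precedes it below -/
import Mathlib

section
/- Let d be a real number with d > 0 and define, for ω > 0, the frequency-dependent fractional order α(ω) = 1 + Log(iω + d)/Log(iω), where Log is the principal complex logarithm. Then α(ω) tends to 1 as ω → 0⁺ (limit taken along positive real ω); in the quasi-static limit the order of the matched fractional oscillator approaches first order. -/
/-- The complex logarithm tends to infinity in norm at the origin. -/
theorem Complex.tendsto_log_nhdsNE_zero_cobounded :
    Filter.Tendsto Complex.log (nhdsWithin 0 {0}ᶜ) (Bornology.cobounded ℂ) := by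
  rw [← tendsto_norm_atTop_iff_cobounded]
  have habs : Filter.Tendsto (fun z : ℂ => |Real.log ‖z‖|) (nhdsWithin 0 {0}ᶜ) Filter.atTop :=
    Filter.tendsto_abs_atBot_atTop.comp
      (Real.tendsto_log_nhdsGT_zero.comp tendsto_norm_nhdsNE_zero)
  refine Filter.tendsto_atTop_mono (fun z => ?_) habs
  rw [← Complex.log_re]
  exact Complex.abs_re_le_norm _


/-- For real `d > 0`, the frequency-dependent order `α(ω) = 1 + Log(iω + d)/Log(iω)` tends to `1`
as `ω → 0⁺` along positive real `ω`. -/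
theorem stmt_10 (d : ℝ) (hd : 0 < d) :
    Filter.Tendsto
      (fun ω : ℝ => (1 : ℂ) + Complex.log (Complex.I * (ω : ℂ) + (d : ℂ)) /
        Complex.log (Complex.I * (ω : ℂ)))
      (nhdsWithin 0 (Set.Ioi 0)) (nhds 1) := by
  have hnum : Filter.Tendsto (fun ω : ℝ => Complex.log (Complex.I * (ω : ℂ) + (d : ℂ)))
      (nhdsWithin 0 (Set.Ioi 0)) (nhds (Complex.log d)) := by
    have hlin : ContinuousAt (fun ω : ℝ => Complex.I * (ω : ℂ) + (d : ℂ)) 0 := by fun_prop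
    have hlog := hlin.clog (by simp [Complex.ofReal_mem_slitPlane, hd])
    simpa using hlog.tendsto.mono_left nhdsWithin_le_nhds
  have harg : Filter.Tendsto (fun ω : ℝ => Complex.I * (ω : ℂ))
      (nhdsWithin 0 (Set.Ioi 0)) (nhdsWithin 0 {0}ᶜ) := by
    refine tendsto_nhdsWithin_iff.2 ⟨?_, ?_⟩
    · have hlin : ContinuousAt (fun ω : ℝ => Complex.I * (ω : ℂ)) 0 := by fun_prop
      simpa using hlin.tendsto.mono_left nhdsWithin_le_nhds
    · filter_upwards [self_mem_nhdsWithin] with ω hω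
      simpa using (Set.mem_Ioi.1 hω).ne'
  have hinv := Filter.tendsto_inv₀_cobounded.comp
    (Complex.tendsto_log_nhdsNE_zero_cobounded.comp harg)
  simpa [div_eq_mul_inv, Function.comp_def] using (hnum.mul hinv).const_add 1
end

section
/- Let 0 < α < 1, let f : ℝ → ℂ be differentiable with continuous derivative f′, and suppose there exist constants C ≥ 0 and a ≥ 0 such that ‖f′(t)‖ ≤ C·e^{a t} for all t ≥ 0. Then for every real s > a, the Laplace transform of the Caputo fractional derivative of f of order α satisfies ∫₀^∞ e^{−s t} · (1/Γ(1−α)) (∫₀^t f′(τ)·(t−τ)^{−α} dτ) dt = s^α · (∫₀^∞ e^{−s t} f(t) dt) − s^{α−1}·f(0). -/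
open MeasureTheory Set Filter Topology in
/-- Continuous functions of exponential order `b < s` have an absolutely convergent Laplace
integral at `s`. -/
theorem integrableOn_cexp_neg_mul_mul_of_norm_le {g : ℝ → ℂ} (hg : Continuous g) {K b s : ℝ}
    (hbs : b < s) (hK : ∀ t : ℝ, 0 ≤ t → ‖g t‖ ≤ K * Real.exp (b * t)) :
    IntegrableOn (fun t : ℝ => Complex.exp (-(s * t : ℝ)) * g t) (Ioi 0) := by
  have hint : IntegrableOn (fun t : ℝ => K * Real.exp ((b - s) * t)) (Ioi 0) :=
    (integrableOn_exp_mul_Ioi (sub_neg.mpr hbs) 0).const_mul K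
  refine Integrable.mono' hint (by fun_prop) ?_
  filter_upwards [ae_restrict_mem measurableSet_Ioi] with t ht
  have hexp : Real.exp ((b - s) * t) = Real.exp (-(s * t)) * Real.exp (b * t) := by
    rw [← Real.exp_add]; ring_nf
  rw [norm_mul, ← Complex.ofReal_neg, Complex.norm_exp_ofReal, hexp]
  calc Real.exp (-(s * t)) * ‖g t‖ ≤ Real.exp (-(s * t)) * (K * Real.exp (b * t)) := by
        gcongr; exact hK t (le_of_lt ht)
    _ = _ := by ring

open Filter Topology in
/-- A function of exponential order `b < s`, damped by `exp (-s t)`, vanishes at infinity. -/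
theorem tendsto_cexp_neg_mul_mul_of_norm_le {g : ℝ → ℂ} {K b s : ℝ}
    (hbs : b < s) (hK : ∀ t : ℝ, 0 ≤ t → ‖g t‖ ≤ K * Real.exp (b * t)) :
    Tendsto (fun t : ℝ => Complex.exp (-(s * t : ℝ)) * g t) atTop (𝓝 0) := by
  have hlim : Tendsto (fun t : ℝ => K * Real.exp ((b - s) * t)) atTop (𝓝 0) := by
    simpa using (Real.tendsto_exp_atBot.comp
      (tendsto_id.const_mul_atTop_of_neg (sub_neg.mpr hbs))).const_mul K
  refine squeeze_zero_norm' ?_ hlim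
  filter_upwards [eventually_ge_atTop 0] with t ht
  have hexp : Real.exp ((b - s) * t) = Real.exp (-(s * t)) * Real.exp (b * t) := by
    rw [← Real.exp_add]; ring_nf
  rw [norm_mul, ← Complex.ofReal_neg, Complex.norm_exp_ofReal, hexp]
  calc Real.exp (-(s * t)) * ‖g t‖ ≤ Real.exp (-(s * t)) * (K * Real.exp (b * t)) := by
        gcongr; exact hK t ht
    _ = _ := by ring

/-- A bound of exponential order on the derivative passes to the function. -/
theorem norm_le_mul_exp_of_norm_deriv_le {f : ℝ → ℂ} (hf : Differentiable ℝ f) {C b : ℝ}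
    (hb : 0 < b) (hbound : ∀ t : ℝ, 0 ≤ t → ‖deriv f t‖ ≤ C * Real.exp (b * t)) {t : ℝ}
    (ht : 0 ≤ t) : ‖f t‖ ≤ (‖f 0‖ + C / b) * Real.exp (b * t) := by
  have hC : 0 ≤ C := by simpa using (norm_nonneg _).trans (hbound 0 le_rfl)
  have hB : ∀ x : ℝ, HasDerivAt (fun x => (‖f 0‖ + C / b) * Real.exp (b * x))
      ((‖f 0‖ + C / b) * (Real.exp (b * x) * b)) x := fun x => by
    simpa using (((hasDerivAt_id x).const_mul b).exp).const_mul (‖f 0‖ + C / b)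
  refine image_norm_le_of_norm_deriv_right_le_deriv_boundary (a := 0) (b := t)
    hf.continuous.continuousOn (fun x _ => (hf x).hasDerivAt.hasDerivWithinAt) ?_ hB ?_
    ⟨ht, le_rfl⟩
  · simpa using div_nonneg hC hb.le
  · intro x hx
    refine (hbound x hx.1).trans ?_
    have hsplit : (‖f 0‖ + C / b) * (Real.exp (b * x) * b)
        = ‖f 0‖ * b * Real.exp (b * x) + C * Real.exp (b * x) := by field_simp
    rw [hsplit]
    have : 0 ≤ ‖f 0‖ * b * Real.exp (b * x) := by positivity
    linarith

open MeasureTheory Set Filter Topology in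
/-- The Laplace transform of a derivative of exponential order. -/
theorem integral_cexp_neg_mul_mul_deriv {f : ℝ → ℂ} (hf : Differentiable ℝ f)
    (hf' : Continuous (deriv f)) {C b s : ℝ} (hb : 0 < b) (hbs : b < s)
    (hbound : ∀ t : ℝ, 0 ≤ t → ‖deriv f t‖ ≤ C * Real.exp (b * t)) :
    ∫ t in Ioi (0 : ℝ), Complex.exp (-(s * t : ℝ)) * deriv f t =
      s * (∫ t in Ioi (0 : ℝ), Complex.exp (-(s * t : ℝ)) * f t) - f 0 := by
  have hfb := fun t (ht : 0 ≤ t) => norm_le_mul_exp_of_norm_deriv_le hf hb hbound ht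
  have hE : ∀ x : ℝ, HasDerivAt (fun t : ℝ => Complex.exp (-(s * t : ℝ)))
      (-s * Complex.exp (-(s * x : ℝ))) x := fun x => by
    have := (((hasDerivAt_id x).const_mul s).ofReal_comp.neg).cexp
    simpa [mul_comm] using! this
  have hzero : Tendsto (fun t : ℝ => Complex.exp (-(s * t : ℝ)) * f t) (𝓝[>] 0) (𝓝 (f 0)) := by
    have hc : Continuous fun t : ℝ => Complex.exp (-(s * t : ℝ)) * f t := by
      have := hf.continuous
      fun_prop
    simpa using (hc.tendsto 0).mono_left nhdsWithin_le_nhds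
  have hint : IntegrableOn (fun t : ℝ => -s * Complex.exp (-(s * t : ℝ)) * f t) (Ioi 0) := by
    simpa only [mul_assoc, IntegrableOn] using
      (integrableOn_cexp_neg_mul_mul_of_norm_le hf.continuous hbs hfb).const_mul (-s : ℂ)
  rw [integral_Ioi_mul_deriv_eq_deriv_mul (fun x _ => hE x) (fun x _ => (hf x).hasDerivAt)
    (integrableOn_cexp_neg_mul_mul_of_norm_le hf' hbs hbound) hint hzero
    (tendsto_cexp_neg_mul_mul_of_norm_le hbs hfb)]
  simp_rw [mul_assoc]
  rw [integral_const_mul]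
  ring

open MeasureTheory Set in
/-- The Laplace transform of `t ^ (-α)`, together with its absolute convergence. -/
theorem integral_cexp_neg_mul_mul_rpow_neg {α s : ℝ} (hα : α < 1) (hs : 0 < s) :
    IntegrableOn (fun t : ℝ => Complex.exp (-(s * t : ℝ)) * ((t ^ (-α) : ℝ) : ℂ)) (Ioi 0) ∧
      ∫ t in Ioi (0 : ℝ), Complex.exp (-(s * t : ℝ)) * ((t ^ (-α) : ℝ) : ℂ) =
        ((s ^ (α - 1) * Real.Gamma (1 - α) : ℝ) : ℂ) := by
  have hval : ∫ t in Ioi (0 : ℝ), Complex.exp (-(s * t : ℝ)) * ((t ^ (-α) : ℝ) : ℂ) =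
      ((s ^ (α - 1) * Real.Gamma (1 - α) : ℝ) : ℂ) := by
    have h := Real.integral_rpow_mul_exp_neg_mul_Ioi (sub_pos.mpr hα) hs
    rw [one_div, Real.inv_rpow hs.le, ← Real.rpow_neg hs.le, neg_sub] at h
    rw [← h, ← integral_complex_ofReal]
    congr 1 with t
    rw [show 1 - α - 1 = -α by ring]
    push_cast
    ring
  refine ⟨Integrable.of_integral_ne_zero ?_, hval⟩
  rw [hval, Complex.ofReal_ne_zero]
  exact (mul_pos (Real.rpow_pos_of_pos hs _) (Real.Gamma_pos_of_pos (sub_pos.mpr hα))).ne'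


/-- Laplace transform of the Caputo fractional derivative of order `α ∈ (0,1)`: for `f`
differentiable with continuous derivative satisfying `‖f′(t)‖ ≤ C·e^(a t)` for `t ≥ 0`, and any
real `s > a`,
`∫₀^∞ e^(−st) · (1/Γ(1−α)) (∫₀^t f′(τ)(t−τ)^(−α) dτ) dt = s^α·(∫₀^∞ e^(−st) f(t) dt) − s^(α−1)·f(0)`. -/
theorem stmt_17 (α : ℝ) (hα0 : 0 < α) (hα1 : α < 1)
    (f : ℝ → ℂ) (hf : Differentiable ℝ f) (hf' : Continuous (deriv f))
    (C a : ℝ) (hC : 0 ≤ C) (ha : 0 ≤ a)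
    (hbound : ∀ t : ℝ, 0 ≤ t → ‖deriv f t‖ ≤ C * Real.exp (a * t))
    (s : ℝ) (hs : a < s) :
    ∫ t in Set.Ioi (0 : ℝ), Complex.exp (-(s * t : ℝ)) *
        ((1 / ((Real.Gamma (1 - α) : ℝ) : ℂ)) *
          ∫ τ in (0 : ℝ)..t, deriv f τ * (((t - τ) ^ (-α) : ℝ) : ℂ)) =
      (s : ℂ) ^ (α : ℂ) * (∫ t in Set.Ioi (0 : ℝ), Complex.exp (-(s * t : ℝ)) * f t) -
        (s : ℂ) ^ ((α : ℂ) - 1) * f 0 := by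

  have hs0 : 0 < s := ha.trans_lt hs
  have hb : ∀ t : ℝ, 0 ≤ t → ‖deriv f t‖ ≤ C * Real.exp ((a + s) / 2 * t) := fun t ht =>
    (hbound t ht).trans (by gcongr; linarith)
  have hbs : (a + s) / 2 < s := by linarith
  obtain ⟨hpow, hpow_eq⟩ := integral_cexp_neg_mul_mul_rpow_neg hα1 hs0
  have hconv := MeasureTheory.integral_posConvolution
    (integrableOn_cexp_neg_mul_mul_of_norm_le hf' hbs hb) hpow (ContinuousLinearMap.mul ℝ ℂ)
  simp only [ContinuousLinearMap.mul_apply'] at hconv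
  rw [integral_cexp_neg_mul_mul_deriv hf hf' (by linarith) hbs hb, hpow_eq] at hconv
  have hΓ : ((Real.Gamma (1 - α) : ℝ) : ℂ) ≠ 0 :=
    Complex.ofReal_ne_zero.mpr (Real.Gamma_pos_of_pos (sub_pos.mpr hα1)).ne'
  have hsC : (s : ℂ) ≠ 0 := Complex.ofReal_ne_zero.mpr hs0.ne'
  have hs_pow : ((s ^ (α - 1) : ℝ) : ℂ) = (s : ℂ) ^ ((α : ℂ) - 1) := by
    rw [Complex.ofReal_cpow hs0.le]
    push_cast
    rfl
  have hs_mul : (s : ℂ) ^ (α : ℂ) = (s : ℂ) ^ ((α : ℂ) - 1) * s := by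
    rw [Complex.cpow_sub _ _ hsC, Complex.cpow_one, div_mul_cancel₀ _ hsC]
  have hintegrand : ∀ t : ℝ, Complex.exp (-(s * t : ℝ)) *
        ((1 / ((Real.Gamma (1 - α) : ℝ) : ℂ)) *
          ∫ τ in (0 : ℝ)..t, deriv f τ * (((t - τ) ^ (-α) : ℝ) : ℂ)) =
      (1 / ((Real.Gamma (1 - α) : ℝ) : ℂ)) * ∫ τ in (0 : ℝ)..t,
        Complex.exp (-(s * τ : ℝ)) * deriv f τ *
          (Complex.exp (-(s * (t - τ) : ℝ)) * (((t - τ) ^ (-α) : ℝ) : ℂ)) := fun t => by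
    rw [mul_left_comm, ← intervalIntegral.integral_const_mul]
    congr 2 with τ
    rw [mul_mul_mul_comm, ← Complex.exp_add]
    congr 2
    push_cast
    ring
  simp_rw [hintegrand]
  rw [MeasureTheory.integral_const_mul, hconv, Complex.ofReal_mul, hs_pow, hs_mul]
  field_simp
end
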